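/- Let L := lcm_{t∈S} (w t). For every s ∈ S, the image of φ_s in the cokernel Hom(X, ℤ)/i(X) has additive order exactly ∑_{t∈S} L/(w t). -/

import Mathlib

open Finset

/-- The group of degree-zero elements of `ℤ^S`. -/
def Xgrp (S : Type*) [Fintype S] : AddSubgroup (S → ℤ) :=
  (AddMonoidHom.mk' (fun x : S → ℤ => ∑ s, x s)
    (by intro x y; simp [Finset.sum_add_distrib])).ker

/-- The monodromy pairing map `i : X → Hom(X, ℤ)`,
`i(y)(x) = ∑ s, (w s) * (y s) * (x s)`. -/
noncomputable def iPair {S : Type*} [Fintype S] (w : S → ℕ) :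
    Xgrp S →+ (Xgrp S →+ ℤ) :=
  AddMonoidHom.mk'
    (fun y => AddMonoidHom.mk'
      (fun x => ∑ s, (w s : ℤ) * (y : S → ℤ) s * (x : S → ℤ) s)
      (by intro x x'; simp [mul_add, Finset.sum_add_distrib]))
    (by
      intro y y'
      ext x
      simp [add_mul, mul_add, Finset.sum_add_distrib])

/-- The functional `φ_s(x) = (w s) * (x s)` on `X`. -/
def phi {S : Type*} [Fintype S] (w : S → ℕ) (s : S) : Xgrp S →+ ℤ :=
  AddMonoidHom.mk' (fun x => (w s : ℤ) * (x : S → ℤ) s) (by intro x y; simp [mul_add])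

theorem mem_Xgrp {S : Type*} [Fintype S] {x : S → ℤ} : x ∈ Xgrp S ↔ ∑ t, x t = 0 := Iff.rfl

theorem iPair_apply {S : Type*} [Fintype S] (w : S → ℕ) (y x : Xgrp S) :
    iPair w y x = ∑ t, (w t : ℤ) * (y : S → ℤ) t * (x : S → ℤ) t := rfl

theorem phi_apply {S : Type*} [Fintype S] (w : S → ℕ) (s : S) (x : Xgrp S) :
    phi w s x = (w s : ℤ) * (x : S → ℤ) s := rfl

/-- A diagonal functional vanishing on degree-zero elements has constant coefficients. -/
theorem eq_of_forall_sum_mul_eq_zero {S : Type*} [Fintype S] {a : S → ℤ}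
    (h : ∀ x ∈ Xgrp S, ∑ r, a r * x r = 0) (t s : S) : a t = a s := by
  classical
  have key := h (Pi.single t 1 - Pi.single s 1) (by simp [mem_Xgrp])
  simpa [mul_sub, Pi.single_apply, sub_eq_zero] using key

/-- `n • φ_s` is in the image of `X` exactly when it is represented, up to a constant `c`, by a
degree-zero element. -/
theorem nsmul_phi_mem_range_iff {S : Type*} [Fintype S] [DecidableEq S] (w : S → ℕ) (s : S)
    (n : ℕ) : n • phi w s ∈ (iPair w).range ↔
      ∃ y ∈ Xgrp S, ∃ c : ℤ, ∀ t, (w t : ℤ) * (y t - (Pi.single s (n : ℤ) : S → ℤ) t) = c := by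
  have diff (y x : Xgrp S) : iPair w y x - (n • phi w s) x =
      ∑ t, (w t : ℤ) * ((y : S → ℤ) t - (Pi.single s (n : ℤ) : S → ℤ) t) * (x : S → ℤ) t := by
    simp [iPair_apply, phi_apply, mul_sub, sub_mul, Pi.single_apply]
    ring
  constructor
  · rintro ⟨y, hy⟩
    refine ⟨y, y.2, _, fun t => eq_of_forall_sum_mul_eq_zero
      (a := fun t => (w t : ℤ) * ((y : S → ℤ) t - (Pi.single s (n : ℤ) : S → ℤ) t))
      (fun x hx => ?_) t s⟩
    rw [← diff y ⟨x, hx⟩, hy, sub_self]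
  · rintro ⟨y, hy, c, hc⟩
    refine ⟨⟨y, hy⟩, AddMonoidHom.ext fun x => sub_eq_zero.mp ?_⟩
    rw [diff]
    simp only [hc, ← Finset.mul_sum, mem_Xgrp.mp x.2, mul_zero]

theorem nsmul_phi_mem_range_iff_dvd {S : Type*} [Fintype S] (w : S → ℕ) (hw : ∀ s, 0 < w s)
    (s : S) (n : ℕ) :
    n • phi w s ∈ (iPair w).range ↔ ∑ t, Finset.univ.lcm w / w t ∣ n := by
  classical
  have hL (t : S) : (w t : ℤ) * ((Finset.univ.lcm w / w t : ℕ) : ℤ) = Finset.univ.lcm w := by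
    exact_mod_cast Nat.mul_div_cancel' (Finset.dvd_lcm (Finset.mem_univ t))
  have hw0 (t : S) : (w t : ℤ) ≠ 0 := by exact_mod_cast (hw t).ne'
  rw [nsmul_phi_mem_range_iff, ← Int.natCast_dvd_natCast]
  constructor
  · rintro ⟨y, hy, c, hc⟩
    have hdvd : Finset.univ.lcm w ∣ c.natAbs :=
      Finset.lcm_dvd fun t _ => Int.natCast_dvd.mp (Dvd.intro _ (hc t))
    obtain ⟨k, rfl⟩ := Int.natCast_dvd.mpr hdvd
    have hy' (t : S) : y t - (Pi.single s (n : ℤ) : S → ℤ) t =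
        ((Finset.univ.lcm w / w t : ℕ) : ℤ) * k := by
      apply mul_left_cancel₀ (hw0 t)
      rw [hc, ← mul_assoc, hL]
    have hsum := Finset.sum_congr rfl fun t (_ : t ∈ Finset.univ) => hy' t
    rw [Finset.sum_sub_distrib, mem_Xgrp.mp hy, ← Finset.sum_mul, Finset.sum_pi_single'] at hsum
    refine ⟨-k, ?_⟩
    push_cast at hsum ⊢
    simp at hsum
    linarith
  · rintro ⟨k, hk⟩
    refine ⟨fun t => (Pi.single s (n : ℤ) : S → ℤ) t - ((Finset.univ.lcm w / w t : ℕ) : ℤ) * k,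
      ?_, -(Finset.univ.lcm w * k), fun t => ?_⟩
    · rw [mem_Xgrp, Finset.sum_sub_distrib, ← Finset.sum_mul, Finset.sum_pi_single', hk]
      simp
    · rw [← hL t]
      ring

/-- with `L = lcm_{t∈S} (w t)`, the image of `φ_s` in the cokernel
`Hom(X, ℤ)/i(X)` has additive order exactly `∑_{t∈S} L / (w t)`. -/
theorem stmt_2 {S : Type*} [Fintype S] (hS : 1 < Fintype.card S)
    (w : S → ℕ) (hw : ∀ s, 0 < w s) (s : S) :
    addOrderOf
        ((QuotientAddGroup.mk (phi w s) : (Xgrp S →+ ℤ) ⧸ (iPair w).range))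
      = ∑ t, Finset.univ.lcm w / w t := by
  refine Nat.dvd_right_iff_eq.mp fun n => ?_
  rw [addOrderOf_dvd_iff_nsmul_eq_zero, ← QuotientAddGroup.mk_nsmul,
    QuotientAddGroup.eq_zero_iff, nsmul_phi_mem_range_iff_dvd w hw]
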